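/- (Main Theorem.) There is an absolute constant c > 0 such that for all positive integers m, n, the Kolmogorov width satisfies d_{⌊mn/2⌋}(B_{1,∞}^{n,m}, ℓ_{2,1}^{n,m}) ≥ c·m. -/

import Mathlib

open Finset

/-- Kolmogorov width with respect to the norm `nrm`. -/
noncomputable def kolWidth {V : Type*} [AddCommGroup V] [Module ℝ V] (k : ℕ)
    (M : Set V) (nrm : V → ℝ) : ℝ :=
  ⨅ L : {L : Submodule ℝ V // Module.finrank ℝ L ≤ k},
    ⨆ x : M, ⨅ y : L.1, nrm (x.1 - y.1)

open scoped RealInnerProductSpace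

/-- The real number `1` or `-1` encoded by a Boolean. -/
noncomputable def boolSign (b : Bool) : ℝ := cond b 1 (-1)

lemma exp_neg_div_sixteen_le {t : ℝ} (h0 : 0 ≤ t) (h1 : t ≤ 1) :
    Real.exp (-(1 / 16) * t) ≤ 1 - t / 20 := by
  have h := Real.abs_exp_sub_one_sub_id_le (x := -(1 / 16) * t)
    (by rw [abs_le]; constructor <;> linarith)
  have := (abs_le.1 h).2
  nlinarith

lemma sum_boolSign_exp_neg_norm_sq_le {E : Type*} [NormedAddCommGroup E]
    [InnerProductSpace ℝ E] (u w : E) (hu : ‖u‖ ≤ 1) :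
    ∑ b : Bool, Real.exp (-(1 / 16) * ‖boolSign b • u + w‖ ^ 2) ≤
      2 * Real.exp (-(1 / 16) * ‖u‖ ^ 2) *
        Real.exp (-(1 / 16) * ‖w - ((1 / 8) * ⟪u, w⟫) • u‖ ^ 2) := by
  have hu2 : ‖u‖ ^ 2 ≤ 1 := pow_le_one₀ (norm_nonneg _) hu
  have e1 : ‖w - ((1 / 8) * ⟪u, w⟫) • u‖ ^ 2 =
      ‖w‖ ^ 2 - (1 / 4 - ‖u‖ ^ 2 / 64) * ⟪u, w⟫ ^ 2 := by
    rw [norm_sub_sq_real, norm_smul, mul_pow, inner_smul_right, real_inner_comm,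
      Real.norm_eq_abs, sq_abs]
    ring
  have e2 : ∀ b : Bool, -(1 / 16) * ‖boolSign b • u + w‖ ^ 2 =
      -(1 / 16) * (‖u‖ ^ 2 + ‖w‖ ^ 2) + -boolSign b * (⟪u, w⟫ / 8) := by
    intro b
    rw [norm_add_sq_real, inner_smul_left, norm_smul]
    cases b <;> simp [boolSign] <;> ring
  simp_rw [e2, Real.exp_add, ← Finset.mul_sum]
  have e3 : ∑ b : Bool, Real.exp (-boolSign b * (⟪u, w⟫ / 8)) = 2 * Real.cosh (⟪u, w⟫ / 8) := by
    rw [Real.cosh_eq]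
    simp [boolSign]
    ring
  have e4 := Real.cosh_le_exp_half_sq (⟪u, w⟫ / 8)
  rw [e3]
  calc Real.exp (-(1 / 16) * (‖u‖ ^ 2 + ‖w‖ ^ 2)) * (2 * Real.cosh (⟪u, w⟫ / 8))
      ≤ Real.exp (-(1 / 16) * (‖u‖ ^ 2 + ‖w‖ ^ 2)) *
          (2 * Real.exp ((⟪u, w⟫ / 8) ^ 2 / 2)) := by gcongr
    _ = 2 * Real.exp (-(1 / 16) * (‖u‖ ^ 2 + ‖w‖ ^ 2) + (⟪u, w⟫ / 8) ^ 2 / 2) := by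
        rw [Real.exp_add]; ring
    _ ≤ 2 * Real.exp (-(1 / 16) * ‖u‖ ^ 2 +
          -(1 / 16) * ‖w - ((1 / 8) * ⟪u, w⟫) • u‖ ^ 2) := by
        rw [e1]
        refine mul_le_mul_of_nonneg_left (Real.exp_le_exp.2 ?_) zero_le_two
        nlinarith [sq_nonneg ⟪u, w⟫]
    _ = _ := by rw [Real.exp_add]; ring

/-- An exponential moment bound for the squared norm of a random signed selection of one vector
from each of `m` blocks of `n` vectors that together satisfy a Bessel inequality. -/
theorem sum_exp_neg_norm_sq_le {E : Type*} [NormedAddCommGroup E] [InnerProductSpace ℝ E]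
    {n : ℕ} (hn : 0 < n) {m : ℕ} (v : Fin m → Fin n → E)
    (hv : ∀ h, ∑ s, ∑ i, ⟪v s i, h⟫ ^ 2 ≤ ‖h‖ ^ 2) :
    ∑ x : Fin m → Fin n × Bool,
        Real.exp (-(1 / 16) * ‖∑ s, boolSign (x s).2 • v s (x s).1‖ ^ 2) ≤
      (2 * n) ^ m * Real.exp (-(∑ s, ∑ i, ‖v s i‖ ^ 2 - m / 4) / (20 * n)) := by
  have hn' : (0 : ℝ) < n := by exact_mod_cast hn
  induction m with
  | zero => simp
  | succ m ih =>
    rw [← (Fin.consEquiv fun _ => Fin n × Bool).sum_comp, Fintype.sum_prod_type,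
      Fintype.sum_prod_type]
    simp only [Fin.consEquiv_apply, Fin.sum_univ_succ, Fin.cons_zero, Fin.cons_succ] at hv ⊢
    set T₀ := ∑ i, ‖v 0 i‖ ^ 2 with hT₀
    set T := ∑ s : Fin m, ∑ i, ‖v s.succ i‖ ^ 2
    have hnorm : ∀ i, ‖v 0 i‖ ^ 2 ≤ 1 := by
      intro i
      have h1 : ⟪v 0 i, v 0 i⟫ ^ 2 ≤ ∑ j, ⟪v 0 j, v 0 i⟫ ^ 2 :=
        Finset.single_le_sum (f := fun j => ⟪v 0 j, v 0 i⟫ ^ 2)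
          (fun _ _ => sq_nonneg _) (Finset.mem_univ i)
      have h2 : 0 ≤ ∑ s : Fin m, ∑ j, ⟪v s.succ j, v 0 i⟫ ^ 2 := by positivity
      have h3 := hv (v 0 i)
      rw [real_inner_self_eq_norm_sq] at h1
      by_contra! hlt
      nlinarith
    have key : ∀ i, ∑ b : Bool, ∑ y : Fin m → Fin n × Bool,
        Real.exp (-(1 / 16) * ‖boolSign b • v 0 i +
          ∑ s, boolSign (y s).2 • v s.succ (y s).1‖ ^ 2) ≤
        2 * (1 - ‖v 0 i‖ ^ 2 / 20) *
          ((2 * n) ^ m * Real.exp (-(T - 1 / 4 - m / 4) / (20 * n))) := by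
      intro i
      set u := v 0 i
      have hu : ‖u‖ ^ 2 ≤ 1 := hnorm i
      have hu1 : ‖u‖ ≤ 1 := by nlinarith [norm_nonneg u]
      set v' : Fin m → Fin n → E :=
        fun s j => v s.succ j - ((1 / 8) * ⟪u, v s.succ j⟫) • u with hv'
      have hrest : ∀ h, ∑ s : Fin m, ∑ j, ⟪v s.succ j, h⟫ ^ 2 ≤ ‖h‖ ^ 2 := by
        intro h
        have : 0 ≤ ∑ j, ⟪v 0 j, h⟫ ^ 2 := by positivity
        linarith [hv h]
      have hbessel : ∀ h, ∑ s, ∑ j, ⟪v' s j, h⟫ ^ 2 ≤ ‖h‖ ^ 2 := by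
        intro h
        have e : ∀ s j, ⟪v' s j, h⟫ = ⟪v s.succ j, h - ((1 / 8) * ⟪u, h⟫) • u⟫ := by
          intro s j
          simp only [hv', inner_sub_left, inner_sub_right, inner_smul_left, inner_smul_right,
            real_inner_comm u]
          simp
          ring
        simp_rw [e]
        refine (hrest _).trans ?_
        rw [norm_sub_sq_real, norm_smul, mul_pow, inner_smul_right, real_inner_comm,
          Real.norm_eq_abs, sq_abs]
        nlinarith [sq_nonneg ⟪u, h⟫]
      have htrace : T - 1 / 4 ≤ ∑ s, ∑ j, ‖v' s j‖ ^ 2 := by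
        have e : ∀ s j, ‖v s.succ j‖ ^ 2 - (1 / 4) * ⟪v s.succ j, u⟫ ^ 2 ≤ ‖v' s j‖ ^ 2 := by
          intro s j
          simp only [hv']
          rw [norm_sub_sq_real, norm_smul, mul_pow, inner_smul_right, real_inner_comm,
            Real.norm_eq_abs, sq_abs]
          nlinarith [sq_nonneg ⟪u, v s.succ j⟫, sq_nonneg (⟪u, v s.succ j⟫ * ‖u‖)]
        have := Finset.sum_le_sum fun s (_ : s ∈ univ) =>
          Finset.sum_le_sum fun j (_ : j ∈ univ) => e s j
        simp only [Finset.sum_sub_distrib, ← Finset.mul_sum] at this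
        linarith [hrest u]
      rw [Finset.sum_comm]
      calc _ ≤ ∑ y : Fin m → Fin n × Bool, 2 * Real.exp (-(1 / 16) * ‖u‖ ^ 2) *
              Real.exp (-(1 / 16) * ‖∑ s, boolSign (y s).2 • v' s (y s).1‖ ^ 2) := by
            refine Finset.sum_le_sum fun y _ => ?_
            refine (sum_boolSign_exp_neg_norm_sq_le u _ hu1).trans_eq ?_
            congr 4
            simp only [hv', smul_sub, Finset.sum_sub_distrib, inner_sum, inner_smul_right,
              Finset.mul_sum, Finset.sum_smul, smul_smul]
            congr 2
            refine Finset.sum_congr rfl fun s _ => ?_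
            congr 1
            ring
        _ ≤ 2 * Real.exp (-(1 / 16) * ‖u‖ ^ 2) *
              ((2 * n) ^ m * Real.exp (-(∑ s, ∑ j, ‖v' s j‖ ^ 2 - m / 4) / (20 * n))) := by
            rw [← Finset.mul_sum]
            gcongr
            exact ih v' hbessel
        _ ≤ _ := by
            have := exp_neg_div_sixteen_le (sq_nonneg ‖u‖) hu
            gcongr
            linarith
    calc _ ≤ ∑ i, 2 * (1 - ‖v 0 i‖ ^ 2 / 20) *
          ((2 * n) ^ m * Real.exp (-(T - 1 / 4 - m / 4) / (20 * n))) :=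
          Finset.sum_le_sum fun i _ => key i
      _ = (2 * n) * (-(T₀ / (20 * n)) + 1) *
          ((2 * n) ^ m * Real.exp (-(T - 1 / 4 - m / 4) / (20 * n))) := by
          rw [← Finset.sum_mul, ← Finset.mul_sum, Finset.sum_sub_distrib, ← Finset.sum_div]
          simp only [sum_const, card_univ, Fintype.card_fin, nsmul_eq_mul, ← hT₀]
          field_simp
          ring
      _ ≤ (2 * n) * Real.exp (-(T₀ / (20 * n))) *
          ((2 * n) ^ m * Real.exp (-(T - 1 / 4 - m / 4) / (20 * n))) := by
          gcongr
          exact Real.add_one_le_exp _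
      _ = (2 * n) ^ (m + 1) * (Real.exp (-(T₀ / (20 * n))) *
          Real.exp (-(T - 1 / 4 - m / 4) / (20 * n))) := by ring
      _ = _ := by
          rw [← Real.exp_add]
          congr 2
          push_cast
          ring

lemma sum_norm_sq_starProjection {E ι : Type*} [NormedAddCommGroup E] [InnerProductSpace ℝ E]
    [FiniteDimensional ℝ E] [Fintype ι] (b : OrthonormalBasis ι ℝ E) (K : Submodule ℝ E) :
    ∑ i, ‖K.starProjection (b i)‖ ^ 2 = Module.finrank ℝ K := by
  have hproj : LinearMap.IsProj K K.starProjection.toLinearMap :=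
    ⟨fun x => K.starProjection_apply_mem x, fun x hx => K.starProjection_eq_self_iff.2 hx⟩
  rw [← hproj.trace, LinearMap.trace_eq_sum_inner _ b]
  refine Finset.sum_congr rfl fun i _ => ?_
  rw [← real_inner_self_eq_norm_sq, Submodule.inner_starProjection_left_eq_right,
    K.starProjection_eq_self_iff.2 (K.starProjection_apply_mem _)]
  rfl

/-- The vector with the signed unit coordinate vector prescribed by `x s` in each block `s`. -/
noncomputable def signedVertex {m n : ℕ} (x : Fin m → Fin n × Bool) :
    EuclideanSpace ℝ (Fin m × Fin n) :=
  ∑ s, boolSign (x s).2 • EuclideanSpace.basisFun (Fin m × Fin n) ℝ (s, (x s).1)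

lemma sum_exp_neg_norm_sq_starProjection_le {m n : ℕ} (hn : 0 < n)
    (K : Submodule ℝ (EuclideanSpace ℝ (Fin m × Fin n))) :
    ∑ x : Fin m → Fin n × Bool, Real.exp (-(1 / 16) * ‖K.starProjection (signedVertex x)‖ ^ 2) ≤
      (2 * n) ^ m * Real.exp (-(Module.finrank ℝ K - m / 4) / (20 * n)) := by
  set b := EuclideanSpace.basisFun (Fin m × Fin n) ℝ with hb
  have h := sum_exp_neg_norm_sq_le hn (fun s i => K.starProjection (b (s, i))) (fun h => by
    simp_rw [Submodule.inner_starProjection_left_eq_right]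
    rw [← Fintype.sum_prod_type' (f := fun s i => ⟪b (s, i), K.starProjection h⟫ ^ 2)]
    rw [b.sum_sq_inner_right]
    exact pow_le_pow_left₀ (norm_nonneg _) (K.norm_starProjection_apply_le h) 2)
  rw [← Fintype.sum_prod_type' (f := fun s i => ‖K.starProjection (b (s, i))‖ ^ 2),
    sum_norm_sq_starProjection] at h
  simpa [signedVertex, map_sum, ← hb] using h

/-- Some signed vertex has large projections to all subspaces of a family indexed by small sets
of blocks. -/
theorem exists_signedVertex_lt_norm_sq {m n : ℕ} (hm : 0 < m) (hn : 0 < n)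
    (K : Finset (Fin m) → Submodule ℝ (EuclideanSpace ℝ (Fin m × Fin n)))
    (hK : ∀ S, (m * n / 2 : ℝ) ≤ Module.finrank ℝ (K S) + #S * n) :
    ∃ x : Fin m → Fin n × Bool, ∀ S : Finset (Fin m), (#S : ℝ) ≤ m / 1000 →
      (m / 1000 : ℝ) < ‖(K S).starProjection (signedVertex x)‖ ^ 2 := by
  have hm' : (0 : ℝ) < m := by exact_mod_cast hm
  have hn' : (0 : ℝ) < n := by exact_mod_cast hn
  have hn1 : (1 : ℝ) ≤ n := by exact_mod_cast hn
  by_contra! hcon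
  set N : ℝ := (2 * n) ^ m with hN
  have hNpos : 0 < N := by positivity
  set w : Finset (Fin m) → ℝ := fun S => Real.exp (6 * (m / 1000) + -6 * #S) with hw
  set good : Finset (Finset (Fin m)) := univ.filter fun S => (#S : ℝ) ≤ m / 1000
  have hcount : N ≤ ∑ x : Fin m → Fin n × Bool, ∑ S ∈ good, w S *
      (Real.exp (m / 16000) *
        Real.exp (-(1 / 16) * ‖(K S).starProjection (signedVertex x)‖ ^ 2)) := by
    have hcard : N = ∑ _x : Fin m → Fin n × Bool, (1 : ℝ) := by
      simp [hN, mul_comm]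
    rw [hcard]
    refine Finset.sum_le_sum fun x _ => ?_
    obtain ⟨S, hS, hx⟩ := hcon x
    refine le_trans ?_ (Finset.single_le_sum (fun T _ => by positivity)
      (Finset.mem_filter.2 ⟨Finset.mem_univ S, hS⟩))
    rw [← Real.exp_add, ← Real.exp_add]
    exact Real.one_le_exp (by linarith)
  have hS : ∀ S ∈ good, ∑ x : Fin m → Fin n × Bool, w S * (Real.exp (m / 16000) *
        Real.exp (-(1 / 16) * ‖(K S).starProjection (signedVertex x)‖ ^ 2)) ≤
      w S * (Real.exp (m / 16000) * (N * Real.exp (-(249 / 20000) * m))) := by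
    intro S hS
    have hS' : (#S : ℝ) ≤ m / 1000 := (Finset.mem_filter.1 hS).2
    rw [← Finset.mul_sum, ← Finset.mul_sum]
    gcongr
    refine (sum_exp_neg_norm_sq_starProjection_le hn (K S)).trans ?_
    gcongr
    rw [div_le_iff₀ (by positivity)]
    have h1 := hK S
    have h2 : (#S : ℝ) * n ≤ m / 1000 * n := by gcongr
    nlinarith
  have hsum : ∑ S ∈ good, w S ≤ Real.exp (6 * (m / 1000) + m / 300) := by
    have hexp : Real.exp (-6) ≤ 1 / 300 := by
      rw [Real.exp_neg, ← one_div]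
      refine one_div_le_one_div_of_le (by norm_num) ?_
      have h1 : (2.7 : ℝ) ≤ Real.exp 1 := by linarith [Real.exp_one_gt_d9]
      calc (300 : ℝ) ≤ 2.7 ^ 6 := by norm_num
        _ ≤ Real.exp 1 ^ 6 := by gcongr
        _ = Real.exp 6 := by rw [← Real.exp_nat_mul]; norm_num
    calc ∑ S ∈ good, w S ≤ ∑ S, w S :=
          Finset.sum_le_sum_of_subset_of_nonneg (Finset.filter_subset _ _)
            fun _ _ _ => by positivity
      _ = Real.exp (6 * (m / 1000)) * (Real.exp (-6) + 1) ^ m := by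
          have h := Fintype.sum_pow_mul_eq_add_pow (Fin m) (Real.exp (-6)) 1
          rw [Fintype.card_fin] at h
          rw [← h, Finset.mul_sum]
          refine Finset.sum_congr rfl fun S _ => ?_
          simp only [hw]
          rw [Real.exp_add, one_pow, mul_one, ← Real.exp_nat_mul, mul_comm (-6 : ℝ)]
      _ ≤ Real.exp (6 * (m / 1000)) * Real.exp (1 / 300) ^ m := by
          gcongr
          linarith [Real.add_one_le_exp (1 / 300 : ℝ)]
      _ = _ := by
          rw [← Real.exp_nat_mul, ← Real.exp_add]
          congr 1
          ring
  have hfinal : N ≤ N * Real.exp (6 * (m / 1000) + m / 300 + m / 16000 + -(249 / 20000) * m) := by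
    calc N ≤ _ := hcount
      _ ≤ ∑ S ∈ good, w S * (Real.exp (m / 16000) * (N * Real.exp (-(249 / 20000) * m))) := by
        rw [Finset.sum_comm]
        exact Finset.sum_le_sum hS
      _ = (∑ S ∈ good, w S) * (Real.exp (m / 16000) * (N * Real.exp (-(249 / 20000) * m))) := by
        rw [Finset.sum_mul]
      _ ≤ Real.exp (6 * (m / 1000) + m / 300) *
          (Real.exp (m / 16000) * (N * Real.exp (-(249 / 20000) * m))) := by gcongr
      _ = _ := by
        simp only [Real.exp_add]
        ring
  have hlt : Real.exp (6 * (m / 1000) + m / 300 + m / 16000 + -(249 / 20000) * m) < 1 :=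
    (Real.exp_lt_exp.2 (by linarith)).trans_eq Real.exp_zero
  nlinarith

/-- The vectors supported on the blocks in `S`. -/
noncomputable def blockSpan {m : ℕ} (n : ℕ) (S : Finset (Fin m)) :
    Submodule ℝ (EuclideanSpace ℝ (Fin m × Fin n)) :=
  Submodule.span ℝ ((S ×ˢ (univ : Finset (Fin n))).image
    (EuclideanSpace.basisFun (Fin m × Fin n) ℝ) : Set (EuclideanSpace ℝ (Fin m × Fin n)))

lemma finrank_blockSpan_le {m : ℕ} (n : ℕ) (S : Finset (Fin m)) :
    Module.finrank ℝ (blockSpan n S) ≤ #S * n := by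
  refine (finrank_span_finset_le_card _).trans (Finset.card_image_le.trans ?_)
  simp

lemma mem_blockSpan {m n : ℕ} {S : Finset (Fin m)} {x : EuclideanSpace ℝ (Fin m × Fin n)}
    (hx : ∀ p, p.1 ∉ S → x p = 0) : x ∈ blockSpan n S := by
  rw [← (EuclideanSpace.basisFun (Fin m × Fin n) ℝ).sum_repr x]
  refine Submodule.sum_mem _ fun p _ => ?_
  by_cases hp : p.1 ∈ S
  · refine Submodule.smul_mem _ _ (Submodule.subset_span ?_)
    exact Finset.mem_coe.2 (Finset.mem_image_of_mem _ (by simp [hp]))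
  · simp [hx p hp]

lemma norm_sq_starProjection_le {m n : ℕ} (S : Finset (Fin m))
    (F : Submodule ℝ (EuclideanSpace ℝ (Fin m × Fin n))) (hS : blockSpan n S ≤ F)
    (x y : EuclideanSpace ℝ (Fin m × Fin n)) (hy : y ∈ F) :
    ‖Fᗮ.starProjection x‖ ^ 2 ≤ ∑ s ∈ Sᶜ, ∑ i, (x (s, i) - y (s, i)) ^ 2 := by
  set u : EuclideanSpace ℝ (Fin m × Fin n) :=
    WithLp.toLp 2 fun p => if p.1 ∈ S then 0 else x p - y p with hu
  have hmem : x - y - u ∈ F := hS (mem_blockSpan fun p hp => by simp [hu, hp])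
  have hxu : x - u ∈ Fᗮᗮ := by
    rw [Submodule.orthogonal_orthogonal]
    convert F.add_mem hmem hy using 1
    abel
  have hproj : Fᗮ.starProjection x = Fᗮ.starProjection u := by
    rw [← sub_eq_zero, ← map_sub]
    exact Submodule.starProjection_apply_eq_zero_iff Fᗮ |>.2 hxu
  rw [hproj]
  refine (pow_le_pow_left₀ (norm_nonneg _) (Fᗮ.norm_starProjection_apply_le u) 2).trans_eq ?_
  rw [EuclideanSpace.real_norm_sq_eq, Fintype.sum_prod_type, ← Finset.sum_compl_add_sum S,
    add_eq_left.2]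
  · refine Finset.sum_congr rfl fun s hs => ?_
    simp [hu, Finset.mem_compl.1 hs]
  · refine Finset.sum_eq_zero fun s hs => ?_
    simp [hu, hs]

/-- Identification of block vectors with vectors of a Euclidean space. -/
noncomputable def blockEquiv (m n : ℕ) :
    (Fin m → Fin n → ℝ) ≃ₗ[ℝ] EuclideanSpace ℝ (Fin m × Fin n) :=
  (LinearEquiv.curry ℝ ℝ (Fin m) (Fin n)).symm ≪≫ₗ (WithLp.linearEquiv 2 ℝ _).symm

lemma signedVertex_apply {m n : ℕ} (x : Fin m → Fin n × Bool) (s : Fin m) (i : Fin n) :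
    signedVertex x (s, i) = if i = (x s).1 then boolSign (x s).2 else 0 := by
  simp only [signedVertex, EuclideanSpace.basisFun_apply, WithLp.ofLp_sum, Finset.sum_apply,
    WithLp.ofLp_smul, Pi.smul_apply, PiLp.single_apply, Prod.mk.injEq, smul_eq_mul,
    mul_ite, mul_one, mul_zero]
  rw [Finset.sum_eq_single s]
  · simp
  · intro t _ ht
    simp [ht.symm]
  · simp

lemma abs_boolSign (b : Bool) : |boolSign b| = 1 := by
  cases b <;> simp [boolSign]

/-- Every subspace of dimension at most half of the total one is far from some vertex of the
product of octahedra. -/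
theorem exists_le_sum_sqrt {m n : ℕ} (hm : 0 < m) (hn : 0 < n)
    (L : Submodule ℝ (Fin m → Fin n → ℝ)) (hL : Module.finrank ℝ L ≤ m * n / 2) :
    ∃ x : Fin m → Fin n → ℝ, (∀ s, ∑ i, |x s i| = 1) ∧
      ∀ y ∈ L, (m / 1000 : ℝ) ≤ ∑ s, √(∑ i, (x s i - y s i) ^ 2) := by
  set F : Finset (Fin m) → Submodule ℝ (EuclideanSpace ℝ (Fin m × Fin n)) :=
    fun S => L.map (blockEquiv m n).toLinearMap ⊔ blockSpan n S with hF
  obtain ⟨x, hx⟩ := exists_signedVertex_lt_norm_sq hm hn (fun S => (F S)ᗮ) fun S => by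
    have h1 := (F S).finrank_add_finrank_orthogonal
    rw [finrank_euclideanSpace, Fintype.card_prod, Fintype.card_fin, Fintype.card_fin] at h1
    have h2 : Module.finrank ℝ (F S) ≤ m * n / 2 + #S * n := by
      refine (Submodule.finrank_add_le_finrank_add_finrank _ _).trans (add_le_add ?_ ?_)
      · rwa [LinearEquiv.finrank_map_eq]
      · exact finrank_blockSpan_le n S
    have h3 : m * n ≤ 2 * (Module.finrank ℝ (F S)ᗮ + #S * n) := by omega
    have h4 : (m * n : ℝ) ≤ 2 * (Module.finrank ℝ (F S)ᗮ + #S * n) := by exact_mod_cast h3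
    linarith
  refine ⟨(blockEquiv m n).symm (signedVertex x), fun s => ?_, fun y hy => ?_⟩
  · have h : ∀ i, (blockEquiv m n).symm (signedVertex x) s i = signedVertex x (s, i) :=
      fun i => rfl
    simp_rw [h, signedVertex_apply, apply_ite abs, abs_boolSign, abs_zero]
    simp
  · set r : Fin m → ℝ :=
      fun s => √(∑ i, ((blockEquiv m n).symm (signedVertex x) s i - y s i) ^ 2) with hr
    have hr0 : ∀ s, 0 ≤ r s := fun s => Real.sqrt_nonneg _
    change (m / 1000 : ℝ) ≤ ∑ s, r s
    by_contra! hlt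
    set S : Finset (Fin m) := univ.filter fun s => 1 < r s with hS
    have hcard : (#S : ℝ) ≤ ∑ s, r s := by
      calc (#S : ℝ) = ∑ s ∈ S, 1 := by simp
        _ ≤ ∑ s ∈ S, r s := Finset.sum_le_sum fun s hs => (Finset.mem_filter.1 hs).2.le
        _ ≤ _ := Finset.sum_le_sum_of_subset_of_nonneg (Finset.subset_univ _) fun s _ _ => hr0 s
    have hlarge := hx S (hcard.trans hlt.le)
    have hsmall := norm_sq_starProjection_le S (F S) le_sup_right (signedVertex x)
      (blockEquiv m n y) (Submodule.mem_sup_left (Submodule.mem_map_of_mem hy))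
    have hsum : ∑ s ∈ Sᶜ, ∑ i, (signedVertex x (s, i) - blockEquiv m n y (s, i)) ^ 2 ≤
        ∑ s, r s := by
      refine le_trans (Finset.sum_le_sum fun s hs => ?_)
        (Finset.sum_le_sum_of_subset_of_nonneg (Finset.subset_univ Sᶜ) fun s _ _ => hr0 s)
      have h1 : r s ≤ 1 := by simpa [hS] using hs
      have h2 : ∑ i, (signedVertex x (s, i) - blockEquiv m n y (s, i)) ^ 2 = r s ^ 2 :=
        (Real.sq_sqrt (Finset.sum_nonneg fun _ _ => sq_nonneg _)).symm
      rw [h2]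
      nlinarith [hr0 s]
    linarith

lemma sum_sqrt_le_card {m n : ℕ} (x : Fin m → Fin n → ℝ) (hx : (⨆ s, ∑ i, |x s i|) ≤ 1) :
    ∑ s, √(∑ i, (x s i) ^ 2) ≤ m := by
  have h : ∀ s, √(∑ i, (x s i) ^ 2) ≤ 1 := by
    intro s
    have h1 : ∑ i, |x s i| ≤ 1 :=
      (le_ciSup (f := fun s => ∑ i, |x s i|) (Set.finite_range _).bddAbove s).trans hx
    refine Real.sqrt_le_iff.2 ⟨zero_le_one, ?_⟩
    rw [one_pow]
    calc ∑ i, (x s i) ^ 2 = ∑ i, |x s i| ^ 2 := by simp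
      _ ≤ (∑ i, |x s i|) ^ 2 := Finset.sum_sq_le_sq_sum_of_nonneg fun i _ => abs_nonneg _
      _ ≤ 1 := pow_le_one₀ (Finset.sum_nonneg fun i _ => abs_nonneg _) h1
  simpa using Finset.sum_le_sum fun s (_ : s ∈ univ) => h s

/-- Main theorem: `d_{⌊mn/2⌋}(B_{1,∞}^{n,m}, ℓ_{2,1}^{n,m}) ≥ c m`. -/
theorem stmt15 :
    ∃ c : ℝ, 0 < c ∧ ∀ m n : ℕ, 0 < m → 0 < n →
      c * m ≤ kolWidth (m * n / 2)
        {x : Fin m → Fin n → ℝ | (⨆ s, ∑ i, |x s i|) ≤ 1}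
        (fun x => ∑ s, Real.sqrt (∑ i, (x s i) ^ 2)) := by
  refine ⟨1 / 1000, by norm_num, fun m n hm hn => ?_⟩
  have : Nonempty (Fin m) := ⟨⟨0, hm⟩⟩
  have : Nonempty {L : Submodule ℝ (Fin m → Fin n → ℝ) // Module.finrank ℝ L ≤ m * n / 2} :=
    ⟨⟨⊥, by simp⟩⟩
  refine le_ciInf fun ⟨L, hL⟩ => ?_
  obtain ⟨x, hx, hdist⟩ := exists_le_sum_sqrt hm hn L hL
  have hmem : x ∈ {x : Fin m → Fin n → ℝ | (⨆ s, ∑ i, |x s i|) ≤ 1} :=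
    ciSup_le fun s => (hx s).le
  refine le_ciSup_of_le ⟨(m : ℝ), ?_⟩ ⟨x, hmem⟩ (le_ciInf fun y => ?_)
  · rintro _ ⟨z, rfl⟩
    refine (ciInf_le ⟨0, ?_⟩ (0 : L)).trans ?_
    · rintro _ ⟨y, rfl⟩
      exact Finset.sum_nonneg fun s _ => Real.sqrt_nonneg _
    · simpa using sum_sqrt_le_card z.1 z.2
  · refine (le_of_eq ?_).trans (hdist y.1 y.2)
    ring
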